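/- arXiv:2308.16402 — 3 statements merged into one kernel-verified Lean document; each statement's English description precedes it below -/
import Mathlib

section
/- Let G be a finite additive abelian group with b elements, let M : Matrix G (Fin v) ℕ be a (0,1)-matrix that is the incidence matrix of an (r, λ)-design (every column sums to r, and for all distinct columns p ≠ q, ∑_x M x p * M x q = λ), and let D : Fin (η * b) → Fin s → G be a (b, s; η)-difference matrix over G. Define X : Matrix (Fin (η * b) × G) (Fin s × Fin v) ℕ by X (k, x) (j, p) = M (x + D k j) p. Then the Gram matrix Xᵀ * X satisfies: (Xᵀ * X) ((j,p), (j,p)) = η * b * r for all j, p; (Xᵀ * X) ((j,p), (j,q)) = η * b * λ for all j and all p ≠ q; and (Xᵀ * X) ((j,p), (j',q)) = η * r^2 for all j ≠ j' and all p, q. (That is, X is the design matrix of a GDD-type spanning bipartite block design SBBD*(s, v, ηb²; (ηbr, ηbλ, ηr², ηr²)).) -/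
open Matrix

/-- A sum over translates of a matrix column product depends only on the relative translation. -/
lemma sum_translate_mul_translate {G ι R : Type*} [AddCommGroup G] [Fintype G] [CommSemiring R]
    (M : Matrix G ι R) (p q : ι) (a c : G) :
    ∑ x, M (x + a) p * M (x + c) q = ∑ x, M (x + (a - c)) p * M x q :=
  Fintype.sum_equiv (Equiv.addRight c) _ _ fun x => by
    have h : x + c + (a - c) = x + a := by abel
    simp [h]

/-- Summing over all relative translations factors the sum of column products. -/
lemma sum_sum_translate_mul {G ι R : Type*} [AddCommGroup G] [Fintype G] [CommSemiring R]
    (M : Matrix G ι R) (p q : ι) :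
    ∑ g, ∑ x, M (x + g) p * M x q = (∑ x, M x p) * ∑ x, M x q := by
  rw [Finset.sum_comm, Finset.mul_sum]
  refine Finset.sum_congr rfl fun x _ => ?_
  rw [← Finset.sum_mul]
  exact congrArg (· * M x q) (Fintype.sum_equiv (Equiv.addLeft x) _ _ fun g => rfl)

/-- If every fibre of `d` has `η` elements, then summing along `d` multiplies sums by `η`. -/
lemma sum_comp_of_card_fiber_eq {κ G R : Type*} [Fintype κ] [Fintype G] [DecidableEq G]
    [Semiring R] (d : κ → G) (η : ℕ)
    (hd : ∀ g, (Finset.univ.filter (fun k => d k = g)).card = η) (F : G → R) :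
    ∑ k, F (d k) = η * ∑ g, F g := by
  rw [← Finset.sum_fiberwise' Finset.univ d F, Finset.mul_sum]
  simp [hd]

/-- Construction of a GDD-type SBBD* from an (r,λ)-design and a (b,s;η)-difference matrix:
the Gram matrix `Xᵀ * X` of the pasted design matrix has diagonal blocks
`ηbr` on the diagonal and `ηbλ` off the diagonal, and off-diagonal blocks constant `ηr²`. -/
theorem stmt0 (b v r lam s η : ℕ) (G : Type) [AddCommGroup G] [Fintype G] [DecidableEq G]
    (hb : Fintype.card G = b)
    (M : Matrix G (Fin v) ℕ)
    (hM01 : ∀ x p, M x p = 0 ∨ M x p = 1)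
    (hMr : ∀ p, ∑ x, M x p = r)
    (hMlam : ∀ p q, p ≠ q → ∑ x, M x p * M x q = lam)
    (D : Fin (η * b) → Fin s → G)
    (hD : ∀ j j', j ≠ j' → ∀ g : G,
      (Finset.univ.filter (fun k => D k j - D k j' = g)).card = η)
    (X : Matrix (Fin (η * b) × G) (Fin s × Fin v) ℕ)
    (hX : ∀ k x j p, X (k, x) (j, p) = M (x + D k j) p) :
    (∀ j p, (Xᵀ * X) (j, p) (j, p) = η * b * r) ∧
    (∀ j p q, p ≠ q → (Xᵀ * X) (j, p) (j, q) = η * b * lam) ∧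
    (∀ j j' p q, j ≠ j' → (Xᵀ * X) (j, p) (j', q) = η * r ^ 2) := by
  have key (j j' p q) : (Xᵀ * X) (j, p) (j', q) =
      ∑ k, ∑ x, M (x + (D k j - D k j')) p * M x q := by
    simp [Matrix.mul_apply, Fintype.sum_prod_type, hX, sum_translate_mul_translate]
  refine ⟨fun j p => ?_, fun j p q hpq => ?_, fun j j' p q hj => ?_⟩
  · have hsq (x) : M x p * M x p = M x p := by
      rcases hM01 x p with h | h <;> simp [h]
    simp [key, hsq, hMr]
  · simp [key, hMlam p q hpq]
  · rw [key, sum_comp_of_card_fiber_eq (fun k => D k j - D k j') η (hD j j' hj)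
      (fun g => ∑ x, M (x + g) p * M x q), sum_sum_translate_mul, hMr, hMr, Nat.cast_id, sq]
end

section
/- Let F be a finite field with q elements, let n ≥ 2, and let V = Fin n → F as an F-vector space. Fix a linear hyperplane W : Submodule F V (a submodule with finrank W = n - 1); the groups are the cosets of W. Let p₁ ≠ p₂ be two points of V lying in the same group, i.e. p₁ - p₂ ∈ W. Then the number N₁ of affine hyperplanes H of V (nonempty affine subspaces H : AffineSubspace F V whose direction has finrank n - 1) with direction H ≠ W that contain both p₁ and p₂ satisfies N₁ * (q - 1) = q * (q^(n-2) - 1), i.e. N₁ = q (q^{n-2} - 1)/(q - 1). -/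
open Module in
/-- Hyperplanes through `v` correspond to lines in the annihilator of the span of `v`. -/
noncomputable def hyperplanesThroughEquiv (K V : Type*) [Field K] [AddCommGroup V] [Module K V]
    [FiniteDimensional K V] (v : V) :
    {U : Submodule K V // finrank K U + 1 = finrank K V ∧ v ∈ U} ≃
      {L : Submodule K (K ∙ v).dualAnnihilator // finrank K L = 1} where
  toFun U := ⟨U.1.dualAnnihilator.comap (K ∙ v).dualAnnihilator.subtype, by
    have hle : U.1.dualAnnihilator ≤ (K ∙ v).dualAnnihilator :=
      Submodule.dualAnnihilator_anti <| (Submodule.span_singleton_le_iff_mem v U.1).2 U.2.2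
    rw [(Submodule.comapSubtypeEquivOfLe hle).finrank_eq]
    have h := Subspace.finrank_add_finrank_dualAnnihilator_eq U.1
    have := U.2.1
    omega⟩
  invFun L := ⟨(L.1.map (K ∙ v).dualAnnihilator.subtype).dualCoannihilator, by
    have h := Subspace.finrank_add_finrank_dualCoannihilator_eq
      (L.1.map (K ∙ v).dualAnnihilator.subtype)
    rw [Submodule.finrank_map_subtype_eq, L.2] at h
    omega, by
    rw [← Submodule.span_singleton_le_iff_mem,
      ← Submodule.le_dualAnnihilator_iff_le_dualCoannihilator]
    exact Submodule.map_subtype_le _ _⟩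
  left_inv U := by
    have hle : U.1.dualAnnihilator ≤ (K ∙ v).dualAnnihilator :=
      Submodule.dualAnnihilator_anti <| (Submodule.span_singleton_le_iff_mem v U.1).2 U.2.2
    ext1
    simp only [Submodule.map_comap_subtype, inf_of_le_right hle]
    exact Subspace.dualAnnihilator_dualCoannihilator_eq
  right_inv L := by
    ext1
    simp only [Subspace.dualCoannihilator_dualAnnihilator_eq]
    exact Submodule.comap_map_eq_of_injective Subtype.val_injective L.1

open Module in
theorem card_hyperplanes_through_mul (K V : Type*) [Field K] [Finite K] [AddCommGroup V]
    [Module K V] [FiniteDimensional K V] {v : V} (hv : v ≠ 0) :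
    Nat.card {U : Submodule K V // finrank K U + 1 = finrank K V ∧ v ∈ U} * (Nat.card K - 1) =
      Nat.card K ^ (finrank K V - 1) - 1 := by
  rw [Nat.card_congr ((hyperplanesThroughEquiv K V v).trans
    (Projectivization.equivSubmodule K (K ∙ v).dualAnnihilator).symm), ← Projectivization.card K,
    Module.natCard_eq_pow_finrank (K := K)]
  have h := Subspace.finrank_add_finrank_dualAnnihilator_eq (K ∙ v)
  rw [finrank_span_singleton hv] at h
  rw [← h, Nat.add_sub_cancel_left]

/-- Affine subspaces through `p₁` and `p₂` correspond, by taking directions, to subspaces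
containing `p₁ -ᵥ p₂`. -/
def AffineSubspace.throughPairEquiv {K V P : Type*} [Ring K] [AddCommGroup V] [Module K V]
    [AddTorsor V P] (p₁ p₂ : P) (C : Submodule K V → Prop) :
    {H : AffineSubspace K P // C H.direction ∧ p₁ ∈ H ∧ p₂ ∈ H} ≃
      {U : Submodule K V // C U ∧ p₁ -ᵥ p₂ ∈ U} where
  toFun H := ⟨H.1.direction, H.2.1, AffineSubspace.vsub_mem_direction H.2.2.1 H.2.2.2⟩
  invFun U := ⟨AffineSubspace.mk' p₂ U.1, by simpa using U.2.1,
    AffineSubspace.mem_mk'.2 U.2.2, AffineSubspace.self_mem_mk' _ _⟩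
  left_inv H := Subtype.ext (AffineSubspace.mk'_eq H.2.2.2)
  right_inv U := Subtype.ext (AffineSubspace.direction_mk' _ _)

/-- In AG(n, q), two distinct points of the same group (coset of the fixed linear hyperplane W)
lie in exactly `λ1 = q (q^{n-2} - 1)/(q - 1)` affine hyperplanes whose direction differs
from W. -/
theorem stmt13 (q n : ℕ) (F : Type) [Field F] [Fintype F]
    (hq : Fintype.card F = q) (hn : 2 ≤ n)
    (W : Submodule F (Fin n → F)) (hW : Module.finrank F W = n - 1)
    (p₁ p₂ : Fin n → F) (hne : p₁ ≠ p₂) (hsame : p₁ - p₂ ∈ W) :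
    Nat.card {H : AffineSubspace F (Fin n → F) //
        (H : Set (Fin n → F)).Nonempty ∧ Module.finrank F H.direction = n - 1 ∧
        H.direction ≠ W ∧ p₁ ∈ H ∧ p₂ ∈ H} * (q - 1) =
      q * (q ^ (n - 2) - 1) := by
  let S : Set (Submodule F (Fin n → F)) :=
    {U | Module.finrank F U + 1 = Module.finrank F (Fin n → F) ∧ p₁ - p₂ ∈ U}
  have hrank (U : Submodule F (Fin n → F)) :
      Module.finrank F U = n - 1 ↔ Module.finrank F U + 1 = Module.finrank F (Fin n → F) := by
    rw [Module.finrank_fin_fun]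
    omega
  have hWS : W ∈ S := ⟨(hrank W).1 hW, hsame⟩
  have hS : S.ncard * (q - 1) = q ^ (n - 1) - 1 := by
    rw [← hq, ← Nat.card_eq_fintype_card]
    refine (card_hyperplanes_through_mul F (Fin n → F) (sub_ne_zero.2 hne)).trans ?_
    rw [Module.finrank_fin_fun]
  have hcard : Nat.card {H : AffineSubspace F (Fin n → F) //
      (H : Set (Fin n → F)).Nonempty ∧ Module.finrank F H.direction = n - 1 ∧
      H.direction ≠ W ∧ p₁ ∈ H ∧ p₂ ∈ H} = S.ncard - 1 := by
    rw [← Set.ncard_sdiff_singleton_of_mem hWS]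
    refine Nat.card_congr <| (Equiv.subtypeEquivRight fun H => ?_).trans <|
      (AffineSubspace.throughPairEquiv p₁ p₂
        fun U => Module.finrank F U = n - 1 ∧ U ≠ W).trans <|
      Equiv.subtypeEquivRight fun U => ?_
    · exact ⟨fun h => ⟨⟨h.2.1, h.2.2.1⟩, h.2.2.2⟩,
        fun h => ⟨⟨p₁, h.2.1⟩, h.1.1, h.1.2, h.2⟩⟩
    · simp only [hrank, S, Set.mem_sdiff, Set.mem_ofPred_eq, Set.mem_singleton_iff, vsub_eq_sub]
      tauto
  rw [hcard, Nat.sub_mul, hS, one_mul, Nat.mul_sub, mul_one, ← pow_succ',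
    show n - 2 + 1 = n - 1 by omega]
  have : 0 < q := hq ▸ Fintype.card_pos
  omega
end

section
/- Let F be a finite field with q elements, let n ≥ 2, and let V = Fin n → F as an F-vector space. Fix a linear hyperplane W : Submodule F V (a submodule with finrank W = n - 1); the groups are the cosets of W. Let p₁, p₂ be two points of V lying in different groups, i.e. p₁ - p₂ ∉ W. Then the number N₂ of affine hyperplanes H of V (nonempty affine subspaces H : AffineSubspace F V whose direction has finrank n - 1) with direction H ≠ W that contain both p₁ and p₂ satisfies N₂ * (q - 1) = q^(n-1) - 1, i.e. N₂ = (q^{n-1} - 1)/(q - 1). Combined with the same-group count λ1 = q (q^{n-2} - 1)/(q - 1), this shows λ2 = λ1 + 1 for this group divisible design. -/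
open Module in
/-- Hyperplanes containing a given subspace `S` correspond to lines in the annihilator of `S`. -/
def hyperplanesContainingEquiv {K V : Type*} [Field K] [AddCommGroup V] [Module K V]
    [FiniteDimensional K V] (S : Submodule K V) :
    {U : Submodule K V // finrank K U + 1 = finrank K V ∧ S ≤ U} ≃
      {L : Submodule K S.dualAnnihilator // finrank K L = 1} where
  toFun U := ⟨U.1.dualAnnihilator.submoduleOf S.dualAnnihilator, by
    have h := Subspace.finrank_add_finrank_dualAnnihilator_eq U.1
    rw [(Submodule.submoduleOfEquivOfLe
      (Submodule.dualAnnihilator_anti U.2.2)).finrank_eq]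
    have := U.2.1
    omega⟩
  invFun L := ⟨(L.1.map S.dualAnnihilator.subtype).dualCoannihilator, by
    have h := Subspace.finrank_add_finrank_dualCoannihilator_eq
      (L.1.map S.dualAnnihilator.subtype)
    rw [Submodule.finrank_map_subtype_eq, L.2] at h
    omega, by
    rw [← Submodule.le_dualAnnihilator_iff_le_dualCoannihilator]
    exact Submodule.map_subtype_le _ _⟩
  left_inv U := by
    ext1
    dsimp only [Submodule.submoduleOf]
    rw [Submodule.map_comap_subtype, inf_eq_right.2 (Submodule.dualAnnihilator_anti U.2.2),
      Subspace.dualAnnihilator_dualCoannihilator_eq]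
  right_inv L := by
    ext1
    dsimp only [Submodule.submoduleOf]
    rw [Subspace.dualCoannihilator_dualAnnihilator_eq,
      Submodule.comap_map_eq_of_injective S.dualAnnihilator.injective_subtype]

open Module in
/-- The number of hyperplanes containing a given subspace `S`. -/
theorem card_hyperplanes_containing {K V : Type*} [Field K] [Finite K] [AddCommGroup V]
    [Module K V] [FiniteDimensional K V] (S : Submodule K V) :
    Nat.card {U : Submodule K V // finrank K U + 1 = finrank K V ∧ S ≤ U} * (Nat.card K - 1) =
      Nat.card K ^ (finrank K V - finrank K S) - 1 := by
  have h := Subspace.finrank_add_finrank_dualAnnihilator_eq S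
  rw [Nat.card_congr ((hyperplanesContainingEquiv S).trans
      (Projectivization.equivSubmodule K S.dualAnnihilator).symm),
    ← Projectivization.card, Module.natCard_eq_pow_finrank (K := K),
    show finrank K V - finrank K S = finrank K S.dualAnnihilator by omega]

/-- Affine subspaces through `p` correspond to their directions. -/
def AffineSubspace.containingPointEquiv {K V P : Type*} [Ring K] [AddCommGroup V] [Module K V]
    [AddTorsor V P] (p : P) :
    {H : AffineSubspace K P // p ∈ H} ≃ Submodule K V where
  toFun H := H.1.direction
  invFun U := ⟨AffineSubspace.mk' p U, AffineSubspace.self_mem_mk' p U⟩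
  left_inv H := Subtype.ext (AffineSubspace.mk'_eq H.2)
  right_inv U := AffineSubspace.direction_mk' p U

/-- In AG(n, q), two points of different groups (cosets of the fixed linear hyperplane W)
lie in exactly `λ2 = (q^{n-1} - 1)/(q - 1)` affine hyperplanes whose direction differs
from W; together with λ1 = q (q^{n-2} - 1)/(q - 1) this gives λ2 = λ1 + 1. -/
theorem stmt14 (q n : ℕ) (F : Type) [Field F] [Fintype F]
    (hq : Fintype.card F = q) (hn : 2 ≤ n)
    (W : Submodule F (Fin n → F)) (hW : Module.finrank F W = n - 1)
    (p₁ p₂ : Fin n → F) (hdiff : p₁ - p₂ ∉ W) :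
    Nat.card {H : AffineSubspace F (Fin n → F) //
        (H : Set (Fin n → F)).Nonempty ∧ Module.finrank F H.direction = n - 1 ∧
        H.direction ≠ W ∧ p₁ ∈ H ∧ p₂ ∈ H} * (q - 1) =
      q ^ (n - 1) - 1 := by
  set v := p₁ - p₂
  have hv0 : v ≠ 0 := fun h => hdiff (h ▸ W.zero_mem)
  have hcard := card_hyperplanes_containing (F ∙ v)
  rw [finrank_span_singleton hv0, Module.finrank_fin_fun,
    Nat.card_eq_fintype_card (α := F), hq] at hcard
  rw [← hcard]
  congr 1
  refine Nat.card_congr (((Equiv.subtypeSubtypeEquivSubtypeInter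
      (fun H : AffineSubspace F (Fin n → F) => p₂ ∈ H)
      (fun H => Module.finrank F H.direction + 1 = n ∧ p₁ ∈ H)).trans
    (Equiv.subtypeEquivRight fun H => ?_)).symm.trans
    ((AffineSubspace.containingPointEquiv p₂).subtypeEquiv fun H => ?_))
  · constructor
    · rintro ⟨h₂, hr, h₁⟩
      refine ⟨⟨p₂, h₂⟩, by omega, fun h => hdiff ?_, h₁, h₂⟩
      exact h ▸ AffineSubspace.vsub_mem_direction h₁ h₂
    · rintro ⟨-, hr, -, h₁, h₂⟩
      exact ⟨h₂, by omega, h₁⟩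
  · rw [Submodule.span_singleton_le_iff_mem]
    exact and_congr_right fun _ =>
      (AffineSubspace.vsub_right_mem_direction_iff_mem H.2 p₁).symm
end
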